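/- In the Hecke algebra H(C̃_n) (defined in the context), the element Z_n = Σ_{i=0}^{n−1} (J_i + J_i⁻¹) is central: Z_n·x = x·Z_n for every x ∈ H(C̃_n) (equivalently, Z_n commutes with each generator g₀, g₁, …, g_n). -/

import Mathlib

noncomputable section

open scoped BigOperators

/-- The defining relations of the Hecke algebra `H(C̃ₙ)` of type `C̃ₙ`, imposed on the
free associative ℂ-algebra on generators `g₀, …, gₙ` (indexed by `Fin (n+1)`). -/
inductive HeckeRel (n : ℕ) (q Q1 Q2 : ℂ) :
    FreeAlgebra ℂ (Fin (n + 1)) → FreeAlgebra ℂ (Fin (n + 1)) → Prop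
  /-- braid relation `gᵢg_{i+1}gᵢ = g_{i+1}gᵢg_{i+1}` for `1 ≤ i ≤ n−2` -/
  | braid (i : ℕ) (h1 : 1 ≤ i) (h2 : i + 2 ≤ n) :
      HeckeRel n q Q1 Q2
        (FreeAlgebra.ι ℂ (⟨i, by omega⟩ : Fin (n + 1)) *
          FreeAlgebra.ι ℂ (⟨i + 1, by omega⟩ : Fin (n + 1)) *
          FreeAlgebra.ι ℂ (⟨i, by omega⟩ : Fin (n + 1)))
        (FreeAlgebra.ι ℂ (⟨i + 1, by omega⟩ : Fin (n + 1)) *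
          FreeAlgebra.ι ℂ (⟨i, by omega⟩ : Fin (n + 1)) *
          FreeAlgebra.ι ℂ (⟨i + 1, by omega⟩ : Fin (n + 1)))
  /-- `g₀g₁g₀g₁ = g₁g₀g₁g₀` -/
  | braid0 (h : 1 ≤ n) :
      HeckeRel n q Q1 Q2
        (FreeAlgebra.ι ℂ (⟨0, by omega⟩ : Fin (n + 1)) *
          FreeAlgebra.ι ℂ (⟨1, by omega⟩ : Fin (n + 1)) *
          FreeAlgebra.ι ℂ (⟨0, by omega⟩ : Fin (n + 1)) *
          FreeAlgebra.ι ℂ (⟨1, by omega⟩ : Fin (n + 1)))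
        (FreeAlgebra.ι ℂ (⟨1, by omega⟩ : Fin (n + 1)) *
          FreeAlgebra.ι ℂ (⟨0, by omega⟩ : Fin (n + 1)) *
          FreeAlgebra.ι ℂ (⟨1, by omega⟩ : Fin (n + 1)) *
          FreeAlgebra.ι ℂ (⟨0, by omega⟩ : Fin (n + 1)))
  /-- `g_{n−1}gₙg_{n−1}gₙ = gₙg_{n−1}gₙg_{n−1}` -/
  | braidn (h : 1 ≤ n) :
      HeckeRel n q Q1 Q2
        (FreeAlgebra.ι ℂ (⟨n - 1, by omega⟩ : Fin (n + 1)) *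
          FreeAlgebra.ι ℂ (⟨n, by omega⟩ : Fin (n + 1)) *
          FreeAlgebra.ι ℂ (⟨n - 1, by omega⟩ : Fin (n + 1)) *
          FreeAlgebra.ι ℂ (⟨n, by omega⟩ : Fin (n + 1)))
        (FreeAlgebra.ι ℂ (⟨n, by omega⟩ : Fin (n + 1)) *
          FreeAlgebra.ι ℂ (⟨n - 1, by omega⟩ : Fin (n + 1)) *
          FreeAlgebra.ι ℂ (⟨n, by omega⟩ : Fin (n + 1)) *
          FreeAlgebra.ι ℂ (⟨n - 1, by omega⟩ : Fin (n + 1)))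
  /-- commuting relation `gᵢgⱼ = gⱼgᵢ` for `|i − j| > 1` -/
  | comm (i j : ℕ) (hij : i + 1 < j) (hj : j ≤ n) :
      HeckeRel n q Q1 Q2
        (FreeAlgebra.ι ℂ (⟨i, by omega⟩ : Fin (n + 1)) *
          FreeAlgebra.ι ℂ (⟨j, by omega⟩ : Fin (n + 1)))
        (FreeAlgebra.ι ℂ (⟨j, by omega⟩ : Fin (n + 1)) *
          FreeAlgebra.ι ℂ (⟨i, by omega⟩ : Fin (n + 1)))
  /-- quadratic relation `(gᵢ − q)(gᵢ + q⁻¹) = 0` for `1 ≤ i ≤ n−1` -/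
  | quad (i : ℕ) (h1 : 1 ≤ i) (h2 : i + 1 ≤ n) :
      HeckeRel n q Q1 Q2
        ((FreeAlgebra.ι ℂ (⟨i, by omega⟩ : Fin (n + 1)) -
            algebraMap ℂ (FreeAlgebra ℂ (Fin (n + 1))) q) *
          (FreeAlgebra.ι ℂ (⟨i, by omega⟩ : Fin (n + 1)) +
            algebraMap ℂ (FreeAlgebra ℂ (Fin (n + 1))) q⁻¹))
        0
  /-- quadratic relation `(g₀ − Q₁)(g₀ + Q₁⁻¹) = 0` -/
  | quad0 :
      HeckeRel n q Q1 Q2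
        ((FreeAlgebra.ι ℂ (⟨0, by omega⟩ : Fin (n + 1)) -
            algebraMap ℂ (FreeAlgebra ℂ (Fin (n + 1))) Q1) *
          (FreeAlgebra.ι ℂ (⟨0, by omega⟩ : Fin (n + 1)) +
            algebraMap ℂ (FreeAlgebra ℂ (Fin (n + 1))) Q1⁻¹))
        0
  /-- quadratic relation `(gₙ − Q₂)(gₙ + Q₂⁻¹) = 0` -/
  | quadn :
      HeckeRel n q Q1 Q2
        ((FreeAlgebra.ι ℂ (⟨n, by omega⟩ : Fin (n + 1)) -
            algebraMap ℂ (FreeAlgebra ℂ (Fin (n + 1))) Q2) *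
          (FreeAlgebra.ι ℂ (⟨n, by omega⟩ : Fin (n + 1)) +
            algebraMap ℂ (FreeAlgebra ℂ (Fin (n + 1))) Q2⁻¹))
        0

/-- The Hecke algebra `H(C̃ₙ)`: the quotient of the free associative ℂ-algebra on
`g₀, …, gₙ` by the two-sided ideal generated by the defining relations. -/
abbrev HeckeC (n : ℕ) (q Q1 Q2 : ℂ) := RingQuot (HeckeRel n q Q1 Q2)

/-- The generator `gᵢ` of `H(C̃ₙ)` (taking the junk value `0` when `i > n`). -/
def HG (n : ℕ) (q Q1 Q2 : ℂ) (i : ℕ) : HeckeC n q Q1 Q2 :=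
  if h : i < n + 1 then
    RingQuot.mkAlgHom ℂ (HeckeRel n q Q1 Q2) (FreeAlgebra.ι ℂ (⟨i, h⟩ : Fin (n + 1)))
  else 0

/-- The Murphy elements: `J₀ = g₁⁻¹g₂⁻¹⋯g_{n−1}⁻¹ · gₙ · g_{n−1}⋯g₂g₁ · g₀` and
`Jᵢ = gᵢ·J_{i−1}·gᵢ`.  (Each generator is a unit, so `Ring.inverse` is its inverse.) -/
def HJ (n : ℕ) (q Q1 Q2 : ℂ) : ℕ → HeckeC n q Q1 Q2
  | 0 =>
      ((List.range (n - 1)).map (fun k => Ring.inverse (HG n q Q1 Q2 (k + 1)))).prod *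
        HG n q Q1 Q2 n *
        (((List.range (n - 1)).map (fun k => HG n q Q1 Q2 (k + 1))).reverse).prod *
        HG n q Q1 Q2 0
  | (i + 1) => HG n q Q1 Q2 (i + 1) * HJ n q Q1 Q2 i * HG n q Q1 Q2 (i + 1)

/-- The braid relations of type `C̃ₙ` for elements `g 0, …, g n` of a group. -/
structure IsBraidC {G : Type*} [Group G] (n : ℕ) (g : ℕ → G) : Prop where
  braid : ∀ i, 1 ≤ i → i + 2 ≤ n → g i * g (i + 1) * g i = g (i + 1) * g i * g (i + 1)
  braid_zero : g 0 * g 1 * g 0 * g 1 = g 1 * g 0 * g 1 * g 0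
  braid_last : ∀ i, i + 1 = n → g i * g n * g i * g n = g n * g i * g n * g i
  comm : ∀ i j, i + 1 < j → j ≤ n → Commute (g i) (g j)

/-- The conjugate `g_k⁻¹ ⋯ g_{k+m-1}⁻¹ g_{k+m} g_{k+m-1} ⋯ g_k`. -/
def braidConj {G : Type*} [Group G] (g : ℕ → G) : ℕ → ℕ → G
  | k, 0 => g k
  | k, m + 1 => (g k)⁻¹ * braidConj g (k + 1) m * g k

/-- The Murphy elements, as elements of a group. -/
def murphy {G : Type*} [Group G] (n : ℕ) (g : ℕ → G) : ℕ → G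
  | 0 => braidConj g 1 (n - 1) * g 0
  | i + 1 => g (i + 1) * murphy n g i * g (i + 1)

section GroupLemmas

variable {G : Type*} [Group G]

lemma mul_inv_mul_inv_of_braid {a b : G} (hab : a * b * a = b * a * b) :
    a * b⁻¹ * a⁻¹ = b⁻¹ * a⁻¹ * b := by
  calc a * b⁻¹ * a⁻¹ = b⁻¹ * a⁻¹ * (a * b * a) * b⁻¹ * a⁻¹ := by group
    _ = b⁻¹ * a⁻¹ * (b * a * b) * b⁻¹ * a⁻¹ := by rw [hab]
    _ = b⁻¹ * a⁻¹ * b := by group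

lemma commute_conj_of_braid {a b v : G} (hab : a * b * a = b * a * b) (hv : Commute b v) :
    Commute a (b⁻¹ * (a⁻¹ * v * a) * b) := by
  have h1 : a * b⁻¹ * a⁻¹ = b⁻¹ * a⁻¹ * b := mul_inv_mul_inv_of_braid hab
  calc a * (b⁻¹ * (a⁻¹ * v * a) * b)
      = (a * b⁻¹ * a⁻¹) * v * a * b := by group
    _ = b⁻¹ * a⁻¹ * (b * v) * a * b := by rw [h1]; group
    _ = b⁻¹ * a⁻¹ * v * (b * a * b) := by rw [hv.eq]; group
    _ = b⁻¹ * (a⁻¹ * v * a) * b * a := by rw [← hab]; group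

lemma commute_sandwich_of_braid {a b v : G} (hab : a * b * a = b * a * b) (hv : Commute b v) :
    Commute a (b * (a * v * a) * b) := by
  calc a * (b * (a * v * a) * b)
      = (a * b * a) * v * a * b := by group
    _ = b * a * (b * v) * a * b := by rw [hab]; group
    _ = b * a * v * (b * a * b) := by rw [hv.eq]; group
    _ = b * (a * v * a) * b * a := by rw [← hab]; group

lemma braid_four_conj {a b v : G} (hab : a * b * a = b * a * b) (hv : Commute a v)
    (h : v * b * v * b = b * v * b * v) :
    (b⁻¹ * v * b) * a * (b⁻¹ * v * b) * a = a * (b⁻¹ * v * b) * a * (b⁻¹ * v * b) := by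
  have h1 : b * a * b⁻¹ = a⁻¹ * b * a := by
    rw [mul_inv_eq_iff_eq_mul, mul_assoc, mul_assoc, eq_inv_mul_iff_mul_eq]
    simpa only [mul_assoc] using hab
  have h2 : a * b⁻¹ * a⁻¹ = b⁻¹ * a⁻¹ * b := mul_inv_mul_inv_of_braid hab
  have hv' : v * a⁻¹ = a⁻¹ * v := hv.symm.inv_right.eq
  have key : (b⁻¹ * v * b) * a * (b⁻¹ * v * b) = b⁻¹ * a⁻¹ * (v * b * v) * a * b := by
    calc (b⁻¹ * v * b) * a * (b⁻¹ * v * b)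
        = b⁻¹ * v * (b * a * b⁻¹) * v * b := by group
      _ = b⁻¹ * (v * a⁻¹) * b * (a * v) * b := by rw [h1]; group
      _ = b⁻¹ * a⁻¹ * (v * b * v) * a * b := by rw [hv', hv.eq]; group
  calc (b⁻¹ * v * b) * a * (b⁻¹ * v * b) * a
      = b⁻¹ * a⁻¹ * (v * b * v) * (a * b * a) := by rw [key]; group
    _ = b⁻¹ * a⁻¹ * (v * b * v * b) * a * b := by rw [hab]; group
    _ = (b⁻¹ * a⁻¹ * b) * (v * b * v) * a * b := by rw [h]; group
    _ = a * (b⁻¹ * a⁻¹ * (v * b * v) * a * b) := by rw [← h2]; group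
    _ = a * (b⁻¹ * v * b) * a * (b⁻¹ * v * b) := by rw [← key]; group

variable {n : ℕ} {g : ℕ → G}

lemma IsBraidC.commute_braidConj_of_lt (h : IsBraidC n g) {i k m : ℕ} (hkm : k + m = n)
    (hik : i + 1 < k) : Commute (g i) (braidConj g k m) := by
  induction m generalizing k with
  | zero => exact h.comm i k hik (by omega)
  | succ m ih =>
    have hc := h.comm i k hik (by omega)
    exact (hc.inv_right.mul_right (ih (by omega) (by omega))).mul_right hc

lemma IsBraidC.commute_braidConj_of_gt (h : IsBraidC n g) {j k m : ℕ} (hkm : k + m = n)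
    (hk : 1 ≤ k) (hkj : k < j) (hjn : j < n) : Commute (g j) (braidConj g k m) := by
  induction m generalizing k with
  | zero => omega
  | succ m ih =>
    rcases Nat.lt_or_ge (k + 1) j with hlt | hge
    · have hc := (h.comm k j hlt hjn.le).symm
      exact (hc.inv_right.mul_right (ih (by omega) (by omega) hlt)).mul_right hc
    · obtain rfl : j = k + 1 := by omega
      obtain ⟨m, rfl⟩ : ∃ m', m = m' + 1 := ⟨m - 1, by omega⟩
      exact commute_conj_of_braid (h.braid k hk (by omega)).symm
        (h.commute_braidConj_of_lt (by omega) (by omega))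

lemma IsBraidC.braid_four_braidConj (h : IsBraidC n g) {k m : ℕ} (hkm : k + 1 + m = n)
    (hk : 1 ≤ k) :
    braidConj g (k + 1) m * g k * braidConj g (k + 1) m * g k =
      g k * braidConj g (k + 1) m * g k * braidConj g (k + 1) m := by
  induction m generalizing k with
  | zero =>
    obtain rfl : k + 1 = n := by omega
    exact (h.braid_last k rfl).symm
  | succ m ih =>
    exact braid_four_conj (h.braid k hk (by omega))
      (h.commute_braidConj_of_lt (by omega) (by omega)) (ih (by omega) (by omega))

lemma murphy_one (hn : 2 ≤ n) :
    murphy n g 1 = braidConj g 2 (n - 2) * (g 1 * g 0 * g 1) := by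
  obtain ⟨m, rfl⟩ : ∃ m, n = m + 2 := ⟨n - 2, by omega⟩
  change g 1 * ((g 1)⁻¹ * braidConj g 2 m * g 1 * g 0) * g 1 =
    braidConj g 2 m * (g 1 * g 0 * g 1)
  group

lemma IsBraidC.commute_zero_murphy (h : IsBraidC n g) {i : ℕ} (hi : 1 ≤ i) (hin : i < n) :
    Commute (g 0) (murphy n g i) := by
  induction i, hi using Nat.le_induction with
  | base =>
    rw [murphy_one (by omega)]
    refine (h.commute_braidConj_of_lt (by omega) (by omega)).mul_right ?_
    simpa only [Commute, SemiconjBy, mul_assoc] using h.braid_zero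
  | succ i hi ih =>
    have hc := h.comm 0 (i + 1) (by omega) hin.le
    exact (hc.mul_right (ih (by omega))).mul_right hc

lemma IsBraidC.commute_murphy_of_gt (h : IsBraidC n g) {i j : ℕ} (hij : i + 1 < j)
    (hj : j < n) : Commute (g j) (murphy n g i) := by
  induction i with
  | zero =>
    exact (h.commute_braidConj_of_gt (by omega) le_rfl (by omega) hj).mul_right
      (h.comm 0 j (by omega) hj.le).symm
  | succ i ih =>
    have hc := (h.comm (i + 1) j (by omega) hj.le).symm
    exact (hc.mul_right (ih (by omega))).mul_right hc

lemma IsBraidC.commute_murphy_of_lt (h : IsBraidC n g) {i j : ℕ} (hj : 1 ≤ j) (hji : j < i)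
    (hi : i < n) : Commute (g j) (murphy n g i) := by
  induction i, hji using Nat.le_induction with
  | base =>
    obtain ⟨j, rfl⟩ : ∃ j', j = j' + 1 := ⟨j - 1, by omega⟩
    exact commute_sandwich_of_braid (h.braid (j + 1) hj (by omega))
      (h.commute_murphy_of_gt (by omega) (by omega))
  | succ i hji ih =>
    have hc := h.comm j (i + 1) (by omega) hi.le
    exact (hc.mul_right (ih (by omega))).mul_right hc

lemma IsBraidC.commute_murphy_zero (h : IsBraidC n g) (hn : 2 ≤ n) {i : ℕ} (hi : i < n) :
    Commute (murphy n g 0) (murphy n g i) := by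
  rcases Nat.eq_zero_or_pos i with rfl | hpos
  · exact Commute.refl _
  induction i, hpos using Nat.le_induction with
  | base =>
    refine Commute.mul_left ?_ (h.commute_zero_murphy le_rfl (by omega))
    rw [murphy_one hn]
    have h4 := h.braid_four_braidConj (k := 1) (m := n - 2) (by omega) le_rfl
    have hc := h.commute_braidConj_of_lt (i := 0) (k := 2) (m := n - 2) (by omega) (by omega)
    have hx : braidConj g 1 (n - 1) = (g 1)⁻¹ * braidConj g 2 (n - 2) * g 1 := by
      obtain ⟨m, rfl⟩ : ∃ m, n = m + 2 := ⟨n - 2, by omega⟩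
      rfl
    rw [hx]
    change braidConj g 2 (n - 2) * g 1 * braidConj g 2 (n - 2) * g 1 =
      g 1 * braidConj g 2 (n - 2) * g 1 * braidConj g 2 (n - 2) at h4
    generalize braidConj g 2 (n - 2) = w at *
    calc (g 1)⁻¹ * w * g 1 * (w * (g 1 * g 0 * g 1))
        = (g 1)⁻¹ * (w * g 1 * w * g 1) * g 0 * g 1 := by group
      _ = w * g 1 * (w * g 0) * g 1 := by rw [h4]; group
      _ = w * (g 1 * g 0 * g 1) * ((g 1)⁻¹ * w * g 1) := by rw [← hc.eq]; group
  | succ i hpos ih =>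
    have hc := (h.commute_murphy_of_gt (i := 0) (j := i + 1) (by omega) hi).symm
    exact (hc.mul_right (ih (by omega))).mul_right hc

lemma apply_add_mem_of_braidConj_mem (S : Subgroup G)
    (k m : ℕ) (hg : ∀ i, k ≤ i → i < k + m → g i ∈ S) (h : braidConj g k m ∈ S) :
    g (k + m) ∈ S := by
  induction m generalizing k with
  | zero => exact h
  | succ m ih =>
    have hk := hg k le_rfl (by omega)
    rw [show k + (m + 1) = k + 1 + m by omega]
    refine ih (k + 1) (fun i h1 h2 => hg i (by omega) (by omega)) ?_
    rwa [braidConj, S.mul_mem_cancel_right hk, S.mul_mem_cancel_left (S.inv_mem hk)] at h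

lemma braidConj_eq_list_prod (g : ℕ → G) (k m : ℕ) :
    braidConj g k m = ((List.range m).map fun i => (g (i + k))⁻¹).prod * g (k + m) *
      (((List.range m).map fun i => g (i + k)).reverse).prod := by
  induction m generalizing k with
  | zero => simp [braidConj]
  | succ m ih =>
    rw [braidConj, ih]
    simp only [List.range_succ_eq_map, List.map_cons, List.map_map, List.prod_cons,
      List.reverse_cons, List.prod_append, List.prod_nil, Function.comp_def, mul_one, zero_add,
      Nat.succ_eq_add_one, mul_assoc, add_assoc, Nat.add_comm 1]

end GroupLemmas

section AlgebraLemmas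

variable {A : Type*} [Ring A]

lemma commute_add_sandwich {v x c : A} (hv : v * v = 1 + c * v) (hc : ∀ y, Commute c y) :
    Commute v (x + v * x * v) := by
  have h1 : v * (v * x * v) = x * v + c * (v * x * v) := by
    calc v * (v * x * v) = (v * v) * (x * v) := by noncomm_ring
      _ = x * v + c * (v * x * v) := by rw [hv]; noncomm_ring
  have h2 : (v * x * v) * v = v * x + c * (v * x * v) := by
    calc (v * x * v) * v = v * x * (v * v) := by noncomm_ring
      _ = v * x + (v * x * c) * v := by rw [hv]; noncomm_ring
      _ = v * x + c * (v * x * v) := by rw [← (hc (v * x)).eq]; noncomm_ring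
  rw [Commute, SemiconjBy, mul_add, add_mul, h1, h2]
  abel

lemma Units.mul_self_of_eq_inv_add {u : Aˣ} {c : A} (h : (u : A) = ↑u⁻¹ + c) :
    (u : A) * u = 1 + c * u := by
  nth_rw 1 [h]
  rw [add_mul, Units.inv_mul]

lemma Units.commute_add_sandwich_inv {u x : Aˣ} {c : A} (h : (u : A) = ↑u⁻¹ + c)
    (hc : ∀ y, Commute c y) :
    Commute (u : A) (((x : A) + ↑x⁻¹) + (↑(u * x * u) + ↑(u * x * u)⁻¹)) := by
  have h1 : Commute (u : A) ((x : A) + u * x * u) :=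
    commute_add_sandwich (Units.mul_self_of_eq_inv_add h) hc
  have h' : ((u⁻¹ : Aˣ) : A) = ↑(u⁻¹)⁻¹ + -c := by rw [inv_inv, h]; abel
  have h2 : Commute (u : A) ((↑x⁻¹ : A) + ↑u⁻¹ * ↑x⁻¹ * ↑u⁻¹) :=
    Commute.units_inv_left_iff.mp
      (commute_add_sandwich (Units.mul_self_of_eq_inv_add h') fun y => (hc y).neg_left)
  have h3 := h1.add_right h2
  simp only [Units.val_mul, mul_inv_rev]
  convert h3 using 1
  rw [mul_assoc (↑u⁻¹ : A)]
  abel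

lemma Units.commute_mul_add_inv {u x : Aˣ} {c d : A} (h : (u : A) = ↑u⁻¹ + c)
    (hx : (x : A) = ↑x⁻¹ + d) (hc : ∀ y, Commute c y) (hd : ∀ y, Commute d y) :
    Commute (u : A) (↑(x * u) + ↑(x * u)⁻¹) := by
  have hu := Units.mul_self_of_eq_inv_add h
  have e1 : (↑u⁻¹ : A) = u - c := by rw [h]; abel
  have e2 : (↑x⁻¹ : A) = x - d := by rw [hx]; abel
  rw [mul_inv_rev, Units.val_mul, Units.val_mul]
  have hxu : (x : A) * u + ↑u⁻¹ * ↑x⁻¹ = (x * u + u * x - c * x) - d * ↑u⁻¹ := by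
    rw [e1, e2, (hd _).eq]; noncomm_ring
  rw [hxu]
  refine Commute.sub_right ?_ ((hd _).symm.mul_right (Units.commute_coe_inv u))
  have a1 : (u : A) * (u * x) = x + c * (u * x) := by rw [← mul_assoc, hu]; noncomm_ring
  have a2 : (x : A) * u * u = x + c * (x * u) := by
    rw [mul_assoc, hu, mul_add, ← mul_assoc, ← (hc _).eq]; noncomm_ring
  have a3 : (u : A) * (c * x) = c * (u * x) := by rw [← mul_assoc, ← (hc _).eq, mul_assoc]
  rw [Commute, SemiconjBy, mul_sub, sub_mul, mul_add, add_mul, a1, a2, a3]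
  noncomm_ring

lemma braidConj_eq_inv_add {g : ℕ → Aˣ} {d : A} (hd : ∀ y, Commute d y) (k m : ℕ)
    (h : (g (k + m) : A) = ↑(g (k + m))⁻¹ + d) :
    ((braidConj g k m : Aˣ) : A) = ↑(braidConj g k m)⁻¹ + d := by
  induction m generalizing k with
  | zero => exact h
  | succ m ih =>
    have h' := ih (k + 1) (by rwa [show k + 1 + m = k + (m + 1) by omega])
    simp only [braidConj, mul_inv_rev, inv_inv, Units.val_mul]
    rw [h', mul_add, add_mul, ← (hd _).eq, mul_assoc d, Units.inv_mul]
    noncomm_ring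

variable {n : ℕ} {g : ℕ → Aˣ}

/-- The sum of the Murphy elements and their inverses commutes with all generators. -/
lemma IsBraidC.commute_sum_murphy (h : IsBraidC n g) (hn : 2 ≤ n)
    (hquad : ∀ i ≤ n, ∃ c : A, (∀ y, Commute c y) ∧ (g i : A) = ↑(g i)⁻¹ + c)
    {j : ℕ} (hj : j ≤ n) :
    Commute (g j : A)
      (∑ i ∈ Finset.range n, (((murphy n g i : Aˣ) : A) + ↑(murphy n g i)⁻¹)) := by
  have hcoe : ∀ {u v : Aˣ}, Commute u v → Commute (u : A) ((v : A) + ↑v⁻¹) := fun {u v} huv =>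
    (Commute.units_val huv).add_right (Commute.units_val huv.inv_right)
  have h0 : Commute (g 0 : A)
      (∑ i ∈ Finset.range n, (((murphy n g i : Aˣ) : A) + ↑(murphy n g i)⁻¹)) := by
    refine Commute.sum_right _ _ _ fun i hi => ?_
    rw [Finset.mem_range] at hi
    rcases Nat.eq_zero_or_pos i with rfl | hpos
    · obtain ⟨c, hc, hgc⟩ := hquad 0 (by omega)
      obtain ⟨d, hd, hgd⟩ := hquad n le_rfl
      refine Units.commute_mul_add_inv hgc (braidConj_eq_inv_add hd 1 (n - 1) ?_) hc hd
      rwa [show 1 + (n - 1) = n by omega]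
    · exact hcoe (h.commute_zero_murphy hpos hi)
  have hmid : ∀ j, 1 ≤ j → j < n → Commute (g j : A)
      (∑ i ∈ Finset.range n, (((murphy n g i : Aˣ) : A) + ↑(murphy n g i)⁻¹)) := by
    intro j hj1 hjn
    obtain ⟨j, rfl⟩ : ∃ j', j = j' + 1 := ⟨j - 1, by omega⟩
    rw [← Finset.add_sum_erase _ _ (Finset.mem_range.mpr (show j < n by omega)),
      ← Finset.add_sum_erase _ _ (Finset.mem_erase.mpr
        ⟨show j + 1 ≠ j by omega, Finset.mem_range.mpr hjn⟩), ← add_assoc]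
    obtain ⟨c, hc, hgc⟩ := hquad (j + 1) hjn.le
    refine Commute.add_right (Units.commute_add_sandwich_inv hgc hc) ?_
    refine Commute.sum_right _ _ _ fun i hi => hcoe ?_
    simp only [Finset.mem_erase, Finset.mem_range] at hi
    rcases Nat.lt_or_ge i j with hlt | hge
    · exact h.commute_murphy_of_gt (by omega) hjn
    · exact h.commute_murphy_of_lt hj1 (by omega) hi.2.2
  have hJ : Commute ((murphy n g 0 : Aˣ) : A)
      (∑ i ∈ Finset.range n, (((murphy n g i : Aˣ) : A) + ↑(murphy n g i)⁻¹)) :=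
    Commute.sum_right _ _ _ fun i hi =>
      hcoe (h.commute_murphy_zero hn (Finset.mem_range.mp hi))
  generalize (∑ i ∈ Finset.range n, (((murphy n g i : Aˣ) : A) + ↑(murphy n g i)⁻¹)) = z at *
  let S : Subgroup Aˣ :=
    { carrier := {u | Commute (u : A) z}
      mul_mem' := fun {a b} ha hb => by
        simpa only [Set.mem_ofPred_eq, Units.val_mul] using Commute.mul_left ha hb
      one_mem' := by simp
      inv_mem' := fun {a} ha => Commute.units_inv_left_iff.mpr ha }
  rcases Nat.eq_zero_or_pos j with rfl | hpos
  · exact h0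
  rcases hj.lt_or_eq with hlt | rfl
  · exact hmid j hpos hlt
  have hlast : g (1 + (j - 1)) ∈ S := by
    refine apply_add_mem_of_braidConj_mem S 1 (j - 1) (fun i h1 h2 => hmid i h1 (by omega)) ?_
    exact (S.mul_mem_cancel_right (show g 0 ∈ S from h0)).mp hJ
  rw [show 1 + (j - 1) = j by omega] at hlast
  exact hlast

end AlgebraLemmas

section Hecke

variable (n : ℕ) (q Q1 Q2 : ℂ)

lemma HG_of_le {i : ℕ} (h : i < n + 1) : HG n q Q1 Q2 i =
    RingQuot.mkAlgHom ℂ (HeckeRel n q Q1 Q2) (FreeAlgebra.ι ℂ (⟨i, h⟩ : Fin (n + 1))) :=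
  dif_pos h

variable {n q Q1 Q2}

/-- The parameter of the quadratic relation satisfied by `gᵢ`. -/
def heckeParam (n : ℕ) (q Q1 Q2 : ℂ) (i : ℕ) : ℂ :=
  if i = 0 then Q1 else if i = n then Q2 else q

lemma HG_quad (hn : 2 ≤ n) {i : ℕ} (hi : i ≤ n) :
    (HG n q Q1 Q2 i - algebraMap ℂ _ (heckeParam n q Q1 Q2 i)) *
      (HG n q Q1 Q2 i + algebraMap ℂ _ (heckeParam n q Q1 Q2 i)⁻¹) = 0 := by
  rw [HG_of_le n q Q1 Q2 (by omega), heckeParam]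
  split_ifs with h0 h1
  · subst h0
    simpa using RingQuot.mkAlgHom_rel ℂ (HeckeRel.quad0 (n := n) (q := q) (Q1 := Q1) (Q2 := Q2))
  · subst h1
    simpa using RingQuot.mkAlgHom_rel ℂ (HeckeRel.quadn (n := i) (q := q) (Q1 := Q1) (Q2 := Q2))
  · simpa using RingQuot.mkAlgHom_rel ℂ
      (HeckeRel.quad (n := n) (q := q) (Q1 := Q1) (Q2 := Q2) i (by omega) (by omega))

lemma mul_sub_eq_one_of_quad {A : Type*} [Ring A] [Algebra ℂ A] {x : A} {p : ℂ} (hp : p ≠ 0)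
    (h : (x - algebraMap ℂ A p) * (x + algebraMap ℂ A p⁻¹) = 0) :
    x * (x - algebraMap ℂ A (p - p⁻¹)) = 1 := by
  have hpp : algebraMap ℂ A p * algebraMap ℂ A p⁻¹ = 1 := by
    rw [← map_mul, mul_inv_cancel₀ hp, map_one]
  have hc := Algebra.commutes p x
  rw [← sub_eq_zero, ← h, map_sub, ← hpp]
  simp only [mul_sub, sub_mul, mul_add]
  rw [hc]
  abel

/-- The generator `gᵢ` as a unit (`1` when `i > n`). -/
def heckeUnit (hn : 2 ≤ n) (hq : q ≠ 0) (hQ1 : Q1 ≠ 0) (hQ2 : Q2 ≠ 0) (i : ℕ) :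
    (HeckeC n q Q1 Q2)ˣ :=
  if hi : i ≤ n then
    have hp : heckeParam n q Q1 Q2 i ≠ 0 := by unfold heckeParam; split_ifs <;> assumption
    { val := HG n q Q1 Q2 i
      inv := HG n q Q1 Q2 i -
        algebraMap ℂ _ (heckeParam n q Q1 Q2 i - (heckeParam n q Q1 Q2 i)⁻¹)
      val_inv := mul_sub_eq_one_of_quad hp (HG_quad hn hi)
      inv_val := by
        rw [sub_mul, Algebra.commutes, ← mul_sub]
        exact mul_sub_eq_one_of_quad hp (HG_quad hn hi) }
  else 1

variable (hn : 2 ≤ n) (hq : q ≠ 0) (hQ1 : Q1 ≠ 0) (hQ2 : Q2 ≠ 0)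

lemma coe_heckeUnit {i : ℕ} (hi : i ≤ n) :
    (heckeUnit hn hq hQ1 hQ2 i : HeckeC n q Q1 Q2) = HG n q Q1 Q2 i := by
  rw [heckeUnit, dif_pos hi]

lemma coe_heckeUnit_eq_inv_add {i : ℕ} (hi : i ≤ n) :
    (heckeUnit hn hq hQ1 hQ2 i : HeckeC n q Q1 Q2) = ↑(heckeUnit hn hq hQ1 hQ2 i)⁻¹ +
      algebraMap ℂ _ (heckeParam n q Q1 Q2 i - (heckeParam n q Q1 Q2 i)⁻¹) := by
  rw [heckeUnit, dif_pos hi]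
  exact (sub_add_cancel _ _).symm

lemma isBraidC_heckeUnit : IsBraidC n (heckeUnit hn hq hQ1 hQ2) where
  braid i h1 h2 := by
    ext
    simp only [Units.val_mul]
    rw [coe_heckeUnit _ _ _ _ (by omega), coe_heckeUnit _ _ _ _ (by omega),
      HG_of_le n q Q1 Q2 (by omega), HG_of_le n q Q1 Q2 (by omega)]
    simpa using RingQuot.mkAlgHom_rel ℂ
      (HeckeRel.braid (n := n) (q := q) (Q1 := Q1) (Q2 := Q2) i h1 h2)
  braid_zero := by
    ext
    simp only [Units.val_mul]
    rw [coe_heckeUnit _ _ _ _ (by omega), coe_heckeUnit _ _ _ _ (by omega),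
      HG_of_le n q Q1 Q2 (by omega), HG_of_le n q Q1 Q2 (by omega)]
    simpa only [map_mul] using RingQuot.mkAlgHom_rel ℂ
      (HeckeRel.braid0 (n := n) (q := q) (Q1 := Q1) (Q2 := Q2) (by omega))
  braid_last i hi := by
    obtain rfl : i = n - 1 := by omega
    ext
    simp only [Units.val_mul]
    rw [coe_heckeUnit _ _ _ _ (by omega), coe_heckeUnit _ _ _ _ (by omega),
      HG_of_le n q Q1 Q2 (by omega), HG_of_le n q Q1 Q2 (by omega)]
    simpa only [map_mul] using RingQuot.mkAlgHom_rel ℂ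
      (HeckeRel.braidn (n := n) (q := q) (Q1 := Q1) (Q2 := Q2) (by omega))
  comm i j hij hj := by
    refine Units.ext ?_
    simp only [Units.val_mul]
    rw [coe_heckeUnit _ _ _ _ (by omega), coe_heckeUnit _ _ _ _ (by omega),
      HG_of_le n q Q1 Q2 (by omega), HG_of_le n q Q1 Q2 (by omega)]
    simpa only [map_mul] using RingQuot.mkAlgHom_rel ℂ
      (HeckeRel.comm (n := n) (q := q) (Q1 := Q1) (Q2 := Q2) i j hij hj)

lemma coe_murphy_heckeUnit {i : ℕ} (hi : i < n) :
    ((murphy n (heckeUnit hn hq hQ1 hQ2) i : (HeckeC n q Q1 Q2)ˣ) : HeckeC n q Q1 Q2) =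
      HJ n q Q1 Q2 i := by
  induction i with
  | zero =>
    have hl : ∀ k ∈ List.range (n - 1), k + 1 ≤ n := fun k hk => by
      rw [List.mem_range] at hk
      omega
    rw [murphy, HJ, braidConj_eq_list_prod, show 1 + (n - 1) = n by omega]
    have hcoe (l : List (HeckeC n q Q1 Q2)ˣ) :
        ((l.prod : (HeckeC n q Q1 Q2)ˣ) : HeckeC n q Q1 Q2) = (l.map Units.val).prod :=
      map_list_prod (Units.coeHom _) l
    rw [Units.val_mul, Units.val_mul, Units.val_mul, hcoe, hcoe, List.map_reverse, List.map_map,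
      List.map_map, coe_heckeUnit hn hq hQ1 hQ2 (Nat.zero_le n),
      coe_heckeUnit hn hq hQ1 hQ2 le_rfl]
    congr 4
    · refine List.map_congr_left fun k hk => ?_
      rw [← coe_heckeUnit hn hq hQ1 hQ2 (hl k hk), Ring.inverse_unit]
      rfl
    · exact List.map_congr_left fun k hk => coe_heckeUnit hn hq hQ1 hQ2 (hl k hk)
  | succ i ih =>
    rw [murphy, HJ, Units.val_mul, Units.val_mul, ih (by omega),
      coe_heckeUnit hn hq hQ1 hQ2 hi.le]

end Hecke

/-- the element `Zₙ = Σ_{i=0}^{n−1} (Jᵢ + Jᵢ⁻¹)` is central in `H(C̃ₙ)`. -/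
theorem Zn_central (n : ℕ) (hn : 2 ≤ n) (q Q1 Q2 : ℂ)
    (hq : q ≠ 0) (hQ1 : Q1 ≠ 0) (hQ2 : Q2 ≠ 0) :
    ∀ x : HeckeC n q Q1 Q2,
      (∑ i ∈ Finset.range n, (HJ n q Q1 Q2 i + Ring.inverse (HJ n q Q1 Q2 i))) * x
        = x * (∑ i ∈ Finset.range n, (HJ n q Q1 Q2 i + Ring.inverse (HJ n q Q1 Q2 i))) := by
  have hsum : ∑ i ∈ Finset.range n, (HJ n q Q1 Q2 i + Ring.inverse (HJ n q Q1 Q2 i)) =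
      ∑ i ∈ Finset.range n, (((murphy n (heckeUnit hn hq hQ1 hQ2) i : (HeckeC n q Q1 Q2)ˣ) : HeckeC n q Q1 Q2) +
        ↑(murphy n (heckeUnit hn hq hQ1 hQ2) i)⁻¹) := by
    refine Finset.sum_congr rfl fun i hi => ?_
    rw [← coe_murphy_heckeUnit hn hq hQ1 hQ2 (Finset.mem_range.mp hi), Ring.inverse_unit]
  have hgen : ∀ j ≤ n, Commute (HG n q Q1 Q2 j)
      (∑ i ∈ Finset.range n, (HJ n q Q1 Q2 i + Ring.inverse (HJ n q Q1 Q2 i))) := by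
    intro j hj
    rw [hsum, ← coe_heckeUnit hn hq hQ1 hQ2 hj]
    exact (isBraidC_heckeUnit hn hq hQ1 hQ2).commute_sum_murphy hn
      (fun i hi => ⟨_, Algebra.commutes _, coe_heckeUnit_eq_inv_add hn hq hQ1 hQ2 hi⟩) hj
  intro x
  obtain ⟨y, rfl⟩ := RingQuot.mkAlgHom_surjective ℂ (HeckeRel n q Q1 Q2) x
  refine Commute.eq (Commute.symm ?_)
  induction y using FreeAlgebra.induction with
  | grade0 r =>
    rw [AlgHom.commutes]
    exact Algebra.commutes _ _
  | grade1 j =>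
    rw [← HG_of_le n q Q1 Q2 j.isLt]
    exact hgen j (Nat.lt_succ_iff.mp j.isLt)
  | mul a b ha hb =>
    rw [map_mul]
    exact ha.mul_left hb
  | add a b ha hb =>
    rw [map_add]
    exact ha.add_left hb

end
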